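/- arXiv:1401.3093 — 3 statements merged into one kernel-verified Lean document; each statement's English description precedes it below -/
import Mathlib

section
/- Let n be a positive integer and let r be an integer with (n−1)/2 ≤ r ≤ n−1. Then B_C(r) ≥ n! / 2^{2(n−r)}. -/
/-- Chebyshev distance between two permutations: the maximum of `|π i - σ i|`. -/
def chebDist {n : ℕ} (π σ : Equiv.Perm (Fin n)) : ℕ :=
  Finset.univ.sup fun i => Nat.dist (π i : ℕ) (σ i : ℕ)

/-- `chebBall n r` is the number of permutations in `S_n` at Chebyshev
distance at most `r` from the identity. -/
def chebBall (n r : ℕ) : ℕ :=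
  (Finset.univ.filter (fun σ : Equiv.Perm (Fin n) => chebDist σ 1 ≤ r)).card

/-- The minimal Chebyshev distance from `π` to a codeword of `C`. -/
noncomputable def chebDistToCode {n : ℕ} (π : Equiv.Perm (Fin n))
    (C : Finset (Equiv.Perm (Fin n))) : ℕ :=
  sInf (chebDist π '' ↑C)

/-- Two fixed-point-free involutions admit a common 2-colouring of their points. -/
theorem exists_coloring_of_fixedPointFree {α : Type*} (a b : Equiv.Perm α)
    (ha : ∀ x, a (a x) = x) (hb : ∀ x, b (b x) = x) (ha' : ∀ x, a x ≠ x) (hb' : ∀ x, b x ≠ x) :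
    ∃ c : α → Prop, ∀ x, (c (a x) ↔ ¬ c x) ∧ (c (b x) ↔ ¬ c x) := by
  have haa : a * a = 1 := Equiv.ext ha
  have hbb : b * b = 1 := Equiv.ext hb
  have hainv : a⁻¹ = a := inv_eq_of_mul_eq_one_left haa
  have hbinv : b⁻¹ = b := inv_eq_of_mul_eq_one_left hbb
  let f : Equiv.Perm α := a * b
  have hfinv : f⁻¹ = b * a := by simp [f, hainv, hbinv]
  have hconj : a * f * a⁻¹ = f⁻¹ := by
    rw [hfinv, hainv]; simp only [f, ← mul_assoc, haa, one_mul]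
  have hpow (l : ℤ) : a * f ^ l = f ^ (-l) * a := by
    have h : (a * f * a⁻¹) ^ l = (f⁻¹) ^ l := by rw [hconj]
    rw [conj_zpow, inv_zpow', mul_inv_eq_iff_eq_mul] at h
    exact h
  have hpow_apply (l : ℤ) (x : α) : a ((f ^ l) x) = (f ^ (-l)) (a x) :=
    congrArg (fun g : Equiv.Perm α => g x) (hpow l)
  have hsep (x : α) : ¬ f.SameCycle x (a x) := by
    rintro ⟨k, hk⟩
    obtain ⟨l, rfl | rfl⟩ := Int.even_or_odd' k
    · apply ha' ((f ^ l) x)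
      rw [hpow_apply, ← hk, ← Equiv.Perm.mul_apply, ← zpow_add]
      congr 2; ring
    · apply hb' ((f ^ l) x)
      apply a.injective
      change f ((f ^ l) x) = _
      rw [hpow_apply, ← hk, ← Equiv.Perm.mul_apply, ← Equiv.Perm.mul_apply, ← zpow_one_add,
        ← zpow_add]
      congr 2; ring
  let q (x : α) : Quotient (Equiv.Perm.SameCycle.setoid f) := Quotient.mk _ x
  have hq (x : α) : q (f x) = q x :=
    Quotient.sound (Equiv.Perm.sameCycle_apply_left.2 (Equiv.Perm.SameCycle.refl f x))
  have hqab (x : α) : q (a (b x)) = q x := hq x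
  have hqb (x : α) : q (b x) = q (a x) := by
    rw [← hqab (b x), hb]
  have hne (x : α) : q x ≠ q (a x) := fun h => hsep x (Quotient.exact h)
  have hflip (x : α) : WellOrderingRel (q (a x)) (q x) ↔ ¬ WellOrderingRel (q x) (q (a x)) := by
    constructor
    · exact fun h h' => asymm_of WellOrderingRel h h'
    · intro h
      rcases trichotomous_of WellOrderingRel (q x) (q (a x)) with h' | h' | h'
      · exact absurd h' h
      · exact absurd h' (hne x)
      · exact h'
  refine ⟨fun x => WellOrderingRel (q x) (q (a x)), fun x => ⟨?_, ?_⟩⟩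
  · simpa only [ha] using hflip x
  · simpa only [hqb, hqab] using hflip x

/-- An involution can be made fixed-point-free on two copies of the type, by exchanging the
copies of each fixed point. -/
theorem exists_fixedPointFree_double {α : Type*} (a : Equiv.Perm α) (ha : ∀ x, a (a x) = x) :
    ∃ a' : Equiv.Perm (α × Bool), (∀ x, a' (a' x) = x) ∧ (∀ x, a' x ≠ x) ∧
      ∀ x s, a x ≠ x → a' (x, s) = (a x, s) := by
  classical
  let g : α × Bool → α × Bool := fun p => if a p.1 = p.1 then (p.1, !p.2) else (a p.1, p.2)
  have hg : Function.Involutive g := by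
    rintro ⟨x, s⟩
    by_cases h : a x = x
    · simp [g, h]
    · have h' : ¬ x = a x := fun e => h e.symm
      simp [g, h, h', ha]
  refine ⟨hg.toPerm, hg, ?_, ?_⟩
  · rintro ⟨x, s⟩
    by_cases h : a x = x <;> simp [g, h]
  · intro x s h
    simp [g, h]

/-- Two involutions admit a common colouring in two colours in which both exchange the
colours of the points they move. -/
theorem exists_coloring_of_involutions {α : Type*} (a b : Equiv.Perm α)
    (ha : ∀ x, a (a x) = x) (hb : ∀ x, b (b x) = x) :
    ∃ c : α → Prop, ∀ x, (a x ≠ x → (c (a x) ↔ ¬ c x)) ∧ (b x ≠ x → (c (b x) ↔ ¬ c x)) := by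
  obtain ⟨a', ha₁, ha₂, ha₃⟩ := exists_fixedPointFree_double a ha
  obtain ⟨b', hb₁, hb₂, hb₃⟩ := exists_fixedPointFree_double b hb
  obtain ⟨c, hc⟩ := exists_coloring_of_fixedPointFree a' b' ha₁ hb₁ ha₂ hb₂
  refine ⟨fun x => c (x, true), fun x => ⟨fun h => ?_, fun h => ?_⟩⟩
  · simpa only [ha₃ x true h] using (hc (x, true)).1
  · simpa only [hb₃ x true h] using (hc (x, true)).2

/-- The involution of `Fin n` exchanging `x` and `x.rev` whenever one of them lies in `s`. -/
def revOn {n : ℕ} (s : Finset (Fin n)) : Equiv.Perm (Fin n) :=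
  Function.Involutive.toPerm (fun x => if x ∈ s ∨ x.rev ∈ s then x.rev else x) <| by
    intro x
    by_cases h : x ∈ s ∨ x.rev ∈ s
    · simp [h, h.symm]
    · simp [h]

theorem revOn_apply {n : ℕ} (s : Finset (Fin n)) (x : Fin n) :
    revOn s x = if x ∈ s ∨ x.rev ∈ s then x.rev else x := rfl

theorem revOn_revOn {n : ℕ} (s : Finset (Fin n)) (x : Fin n) : revOn s (revOn s x) = x :=
  Function.Involutive.toPerm_involutive _ x

/-- The set of elements of `Fin n` with value less than `d`. -/
def lowerPart (n d : ℕ) : Finset (Fin n) := Finset.univ.filter fun x => (x : ℕ) < d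

theorem mem_lowerPart {n d : ℕ} {x : Fin n} : x ∈ lowerPart n d ↔ (x : ℕ) < d := by
  simp [lowerPart]

theorem card_lowerPart_le (n d : ℕ) : (lowerPart n d).card ≤ d := by
  calc (lowerPart n d).card ≤ (Finset.range d).card :=
        Finset.card_le_card_of_injOn Fin.val
          (fun x hx => by simpa using mem_lowerPart.1 hx) (Fin.val_injective.injOn)
    _ = d := Finset.card_range d

/-- Reversing suitable pairs moves the points coloured `c` away from the top `d` places and the
others away from the bottom `d` places. -/
theorem exists_revOn_sorting {n d : ℕ} (hd : 2 * d < n) (c : Fin n → Prop)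
    (hc : ∀ x, revOn (lowerPart n d) x ≠ x → (c (revOn (lowerPart n d) x) ↔ ¬ c x)) :
    ∃ s ⊆ lowerPart n d, ∀ x,
      ((revOn s x : ℕ) < d → c x) ∧ (n - d ≤ (revOn s x : ℕ) → ¬ c x) := by
  classical
  have hrev (x : Fin n) (hx : (x : ℕ) < d) : c x.rev ↔ ¬ c x := by
    have hval : revOn (lowerPart n d) x = x.rev := by simp [revOn_apply, mem_lowerPart, hx]
    have hne : x.rev ≠ x := by
      intro h
      have := congrArg Fin.val h
      rw [Fin.val_rev] at this
      omega
    have h := hc x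
    rw [hval] at h
    exact h hne
  refine ⟨(lowerPart n d).filter fun x => ¬ c x, Finset.filter_subset _ _, fun x => ?_⟩
  have hx := x.isLt
  have hr := hrev x
  have hr' := hrev x.rev
  rw [Fin.rev_rev] at hr'
  rw [revOn_apply]
  simp only [Finset.mem_filter, mem_lowerPart]
  split_ifs with h
  · simp only [Fin.val_rev] at *
    constructor
    · intro h'
      have : ¬ (x : ℕ) < d := by omega
      tauto
    · intro h'
      have : ¬ n - ((x : ℕ) + 1) < d := by omega
      tauto
  · simp only [Fin.val_rev] at *
    constructor
    · tauto
    · intro h'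
      have : n - ((x : ℕ) + 1) < d := by omega
      tauto

/-- Every permutation enters the Chebyshev ball of radius `r` after reversing suitable pairs of
positions and of values. -/
theorem exists_revOn_mul_mul_revOn_mem_ball {n d r : ℕ} (hd : 2 * d < n) (hr : n = r + 1 + d)
    (σ : Equiv.Perm (Fin n)) :
    ∃ s ⊆ lowerPart n d, ∃ t ⊆ lowerPart n d, chebDist (revOn t * σ * revOn s) 1 ≤ r := by
  let a := revOn (lowerPart n d)
  have ha : ∀ x, a (a x) = x := revOn_revOn _
  obtain ⟨c, hc⟩ := exists_coloring_of_involutions a (σ⁻¹ * a * σ) ha (fun x => by simp [ha])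
  obtain ⟨s, hs, hs'⟩ := exists_revOn_sorting hd c (fun x => (hc x).1)
  obtain ⟨t, ht, ht'⟩ := exists_revOn_sorting hd (fun v => c (σ⁻¹ v)) (fun v hv => by
    have h := (hc (σ⁻¹ v)).2
    simp only [Equiv.Perm.mul_apply, Equiv.Perm.coe_inv, Equiv.apply_symm_apply] at h
    exact h fun e => hv (σ⁻¹.injective e))
  refine ⟨s, hs, t, ht, Finset.sup_le fun y _ => ?_⟩
  have hy := hs' (revOn s y)
  have hv := ht' (σ (revOn s y))
  rw [revOn_revOn] at hy
  simp only [Equiv.Perm.coe_inv, Equiv.symm_apply_apply] at hv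
  simp only [Equiv.Perm.mul_apply, Equiv.Perm.one_apply]
  have hy_lt := y.isLt
  have hv_lt := (revOn t (σ (revOn s y))).isLt
  have hlow : (y : ℕ) < d → ¬ n - d ≤ (revOn t (σ (revOn s y)) : ℕ) :=
    fun h h' => hv.2 h' (hy.1 h)
  have hhigh : n - d ≤ (y : ℕ) → ¬ (revOn t (σ (revOn s y)) : ℕ) < d :=
    fun h h' => hy.2 h (hv.1 h')
  rw [Nat.dist]
  omega

theorem factorial_le_chebBall_mul {n d r : ℕ} (hd : 2 * d < n) (hr : n = r + 1 + d) :
    n.factorial ≤ chebBall n r * 2 ^ (2 * d) := by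
  let ball := Finset.univ.filter fun σ : Equiv.Perm (Fin n) => chebDist σ 1 ≤ r
  let P := (lowerPart n d).powerset
  have hP : P.card ≤ 2 ^ d := by
    rw [Finset.card_powerset]
    exact Nat.pow_le_pow_right two_pos (card_lowerPart_le n d)
  have hcover : (Finset.univ : Finset (Equiv.Perm (Fin n))) ⊆
      (ball ×ˢ P ×ˢ P).image fun p => revOn p.2.2 * p.1 * revOn p.2.1 := by
    intro σ _
    obtain ⟨s, hs, t, ht, h⟩ := exists_revOn_mul_mul_revOn_mem_ball hd hr σ
    refine Finset.mem_image.2 ⟨(revOn t * σ * revOn s, s, t), ?_, ?_⟩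
    · simp [ball, P, hs, ht, h]
    · ext x
      simp [revOn_revOn]
  calc n.factorial = (Finset.univ : Finset (Equiv.Perm (Fin n))).card := by
        rw [Finset.card_univ, Fintype.card_perm, Fintype.card_fin]
    _ ≤ (ball ×ˢ P ×ˢ P).card := (Finset.card_le_card hcover).trans Finset.card_image_le
    _ = ball.card * (P.card * P.card) := by simp only [Finset.card_product]
    _ ≤ ball.card * (2 ^ d * 2 ^ d) := by gcongr
    _ = chebBall n r * 2 ^ (2 * d) := by rw [← pow_add, two_mul]; rfl

/-- For `(n-1)/2 ≤ r ≤ n-1`, the Chebyshev ball satisfies `B_C(r) ≥ n!/2^(2(n-r))`. -/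
theorem stmt_17 (n r : ℕ) (hn : 0 < n) (h1 : ((n : ℝ) - 1) / 2 ≤ (r : ℝ)) (h2 : r ≤ n - 1) :
    (chebBall n r : ℝ) ≥ (n.factorial : ℝ) / 2 ^ (2 * (n - r)) := by
  have hnr : n ≤ 2 * r + 1 := by
    have : (n : ℝ) ≤ 2 * r + 1 := by linarith
    exact_mod_cast this
  have h := factorial_le_chebBall_mul (n := n) (d := n - 1 - r) (r := r) (by omega) (by omega)
  rw [ge_iff_le, div_le_iff₀ (by positivity)]
  have hpow : 2 ^ (2 * (n - 1 - r)) ≤ 2 ^ (2 * (n - r)) :=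
    Nat.pow_le_pow_right two_pos (by omega)
  exact_mod_cast h.trans (Nat.mul_le_mul_left _ hpow)
end

section
/- Let n and d be positive integers with 1 ≤ d ≤ n−1. There exists a code C ⊆ S_n of size |C| = n! / ((d+1)!^{⌊n/(d+1)⌋} · (n mod (d+1))!) whose covering radius in the Chebyshev metric is exactly d; that is, every permutation σ ∈ S_n satisfies d_C(σ,C) ≤ d, and there exists a permutation σ ∈ S_n with d_C(σ,C) = d. -/
/-- The index of the length-`m` block of consecutive values containing `a`. -/
def blockIndex (n m : ℕ) (a : Fin n) : Fin (n / m + 1) :=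
  ⟨a / m, Nat.lt_succ_of_le (Nat.div_le_div_right a.2.le)⟩

theorem card_fin_interval {n a b : ℕ} (hb : b ≤ n) (p : Fin n → Prop) [DecidablePred p]
    (hp : ∀ i : Fin n, p i ↔ a ≤ (i : ℕ) ∧ (i : ℕ) < b) :
    (Finset.univ.filter p).card = b - a := by
  rw [← Nat.card_Ico, ← Finset.card_map Fin.valEmbedding]
  congr 1
  ext x
  simp only [Finset.mem_map, Finset.mem_filter, Finset.mem_univ, true_and, hp, Finset.mem_Ico,
    Fin.valEmbedding_apply]
  constructor
  · rintro ⟨i, hi, rfl⟩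
    exact hi
  · intro hx
    exact ⟨⟨x, by omega⟩, hx, rfl⟩

theorem prod_factorial_card_blockIndex (n m : ℕ) (hm : 0 < m) :
    ∏ b, (Fintype.card {a // blockIndex n m a = b}).factorial =
      m.factorial ^ (n / m) * (n % m).factorial := by
  have hn : m * (n / m) + n % m = n := Nat.div_add_mod n m
  rw [Fin.prod_univ_castSucc]
  congr 1
  · rw [Finset.prod_congr rfl (g := fun _ => m.factorial)]
    · simp
    · intro b _
      have hb : m * (b + 1 : ℕ) ≤ m * (n / m) := Nat.mul_le_mul_left m b.2
      rw [Fintype.card_subtype, card_fin_interval (a := m * b) (b := m * (b + 1)) (by omega)]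
      · rw [Nat.mul_succ, Nat.add_sub_cancel_left]
      · intro i
        rw [Fin.ext_iff]
        simp only [blockIndex, Fin.val_castSucc]
        rw [Nat.div_eq_iff hm, mul_comm m, mul_comm m, Nat.succ_mul]
        omega
  · rw [Fintype.card_subtype, card_fin_interval (a := m * (n / m)) (b := n) le_rfl]
    · congr 1
      omega
    · intro i
      have hi : (i : ℕ) / m ≤ n / m := Nat.div_le_div_right i.2.le
      rw [Fin.ext_iff]
      simp only [blockIndex, Fin.val_last, i.2, and_true]
      rw [mul_comm, ← Nat.le_div_iff_mul_le hm]
      omega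

/-- The fibers of `σ ↦ f ∘ σ` all have the size of the stabilizer of `f`. -/
theorem card_image_comp_perm_mul {α β : Type*} [Fintype α] [DecidableEq α] [Fintype β]
    [DecidableEq β] (f : α → β) :
    (Finset.univ.image fun σ : Equiv.Perm α => f ∘ σ).card *
      ∏ b, (Fintype.card {a // f a = b}).factorial = (Fintype.card α).factorial := by
  rw [← DomMulAct.stabilizer_card, ← Fintype.card_perm, ← Finset.card_univ (α := Equiv.Perm α),
    Finset.card_eq_sum_card_image fun σ : Equiv.Perm α => f ∘ σ]
  symm
  apply Finset.sum_const_nat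
  intro w hw
  obtain ⟨τ, -, rfl⟩ := Finset.mem_image.1 hw
  rw [Fintype.card_subtype]
  refine Finset.card_bij' (fun σ _ => σ * τ⁻¹) (fun σ _ => σ * τ) ?_ ?_ ?_ ?_
  · intro σ hσ
    simp only [Finset.mem_filter, Finset.mem_univ, true_and] at hσ ⊢
    funext x
    simpa using congrFun hσ (τ⁻¹ x)
  · intro σ hσ
    simp only [Finset.mem_filter, Finset.mem_univ, true_and] at hσ ⊢
    funext x
    simpa using congrFun hσ (τ x)
  · intro σ _
    simp
  · intro σ _
    simp

theorem dist_le_chebDist {n : ℕ} (π σ : Equiv.Perm (Fin n)) (i : Fin n) :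
    Nat.dist (π i) (σ i) ≤ chebDist π σ :=
  Finset.le_sup (f := fun i => Nat.dist (π i : ℕ) (σ i : ℕ)) (Finset.mem_univ i)

theorem chebDist_le_of_blockIndex_eq {n d : ℕ} {π σ : Equiv.Perm (Fin n)}
    (h : blockIndex n (d + 1) ∘ π = blockIndex n (d + 1) ∘ σ) : chebDist π σ ≤ d := by
  refine Finset.sup_le fun i _ => ?_
  have hi : (π i : ℕ) / (d + 1) = (σ i : ℕ) / (d + 1) := congrArg Fin.val (congrFun h i)
  have hπ := Nat.div_add_mod (π i : ℕ) (d + 1)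
  have hσ := Nat.div_add_mod (σ i : ℕ) (d + 1)
  have hπ' : (π i : ℕ) % (d + 1) < d + 1 := Nat.mod_lt _ d.succ_pos
  have hσ' : (σ i : ℕ) % (d + 1) < d + 1 := Nat.mod_lt _ d.succ_pos
  rw [hi] at hπ
  generalize (d + 1) * ((σ i : ℕ) / (d + 1)) = q at hπ hσ
  unfold Nat.dist
  omega

/-- Within its block class, a permutation can be modified to send a given point to a value
at least `d`. -/
theorem exists_blockIndex_eq_and_le_apply {n d : ℕ} (hdn : d < n) (τ : Equiv.Perm (Fin n))
    (i : Fin n) :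
    ∃ c : Equiv.Perm (Fin n),
      blockIndex n (d + 1) ∘ c = blockIndex n (d + 1) ∘ τ ∧ d ≤ (c i : ℕ) := by
  by_cases h : d ≤ (τ i : ℕ)
  · exact ⟨τ, rfl, h⟩
  refine ⟨Equiv.swap (τ i) ⟨d, hdn⟩ * τ, ?_, by simp⟩
  have hb : blockIndex n (d + 1) (τ i) = blockIndex n (d + 1) ⟨d, hdn⟩ := by
    apply Fin.ext
    simp only [blockIndex]
    rw [Nat.div_eq_of_lt (by omega), Nat.div_eq_of_lt (by omega)]
  funext x
  simp only [Function.comp_apply, Equiv.Perm.mul_apply, Equiv.swap_apply_def]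
  split_ifs with h₁ h₂
  · rw [h₁, hb]
  · rw [h₂, hb]
  · rfl

/-- There is a code of size `n!/((d+1)!^⌊n/(d+1)⌋·(n mod (d+1))!)` with Chebyshev covering
radius exactly `d`. -/
theorem stmt_18 (n d : ℕ) (hd : 1 ≤ d) (hdn : d ≤ n - 1) :
    ∃ C : Finset (Equiv.Perm (Fin n)),
      C.card * ((d + 1).factorial ^ (n / (d + 1)) * (n % (d + 1)).factorial) = n.factorial ∧
      (∀ σ : Equiv.Perm (Fin n), ∃ c ∈ C, chebDist σ c ≤ d) ∧
      ∃ σ : Equiv.Perm (Fin n), ∀ c ∈ C, d ≤ chebDist σ c := by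
  classical
  let f := blockIndex n (d + 1)
  let W := Finset.univ.image fun σ : Equiv.Perm (Fin n) => f ∘ σ
  let z : Fin n := ⟨0, by omega⟩
  have hrep : ∀ w : Fin n → Fin (n / (d + 1) + 1), ∃ c : Equiv.Perm (Fin n),
      w ∈ W → f ∘ c = w ∧ d ≤ (c z : ℕ) := by
    intro w
    by_cases hw : w ∈ W
    · obtain ⟨τ, -, rfl⟩ := Finset.mem_image.1 hw
      obtain ⟨c, hc⟩ := exists_blockIndex_eq_and_le_apply (d := d) (by omega) τ z
      exact ⟨c, fun _ => hc⟩
    · exact ⟨1, fun h => absurd h hw⟩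
  choose g hg using hrep
  refine ⟨W.image g, ?_, ?_, 1, ?_⟩
  · rw [Finset.card_image_of_injOn, ← prod_factorial_card_blockIndex n (d + 1) d.succ_pos]
    · simpa using card_image_comp_perm_mul f
    · intro v hv w hw hvw
      rw [← (hg v hv).1, ← (hg w hw).1, hvw]
  · intro σ
    have hσ : f ∘ σ ∈ W := Finset.mem_image_of_mem _ (Finset.mem_univ σ)
    exact ⟨g (f ∘ σ), Finset.mem_image_of_mem g hσ,
      chebDist_le_of_blockIndex_eq (hg _ hσ).1.symm⟩
  · intro c hc
    obtain ⟨w, hw, rfl⟩ := Finset.mem_image.1 hc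
    refine le_trans ?_ (dist_le_chebDist 1 (g w) z)
    simpa [z, Nat.dist] using (hg w hw).2
end

section
/- Let n ≥ 2 be an integer and D a positive integer. If 1 ≤ D ≤ (n−1)/2, then there exists a code C ⊆ S_n with |C| ≤ ⌈ln(n!) · 2^{2D} · n^n / (2D+1)^n⌉ such that every permutation π ∈ S_n satisfies d_C(π,C) ≤ D; and if (n−1)/2 ≤ D ≤ n−1, then there exists a code C ⊆ S_n with |C| ≤ ⌈ln(n!) · 2^{2(n−D)}⌉ such that every permutation π ∈ S_n satisfies d_C(π,C) ≤ D. -/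
open MvPolynomial in
/-- Evaluation of a homogeneous polynomial at a rescaled point. -/
lemma MvPolynomial.IsHomogeneous.eval_smul_pow {ι R : Type*} [CommSemiring R]
    {p : MvPolynomial ι R} {m : ℕ} (hp : p.IsHomogeneous m) (c : R) (z : ι → R) :
    eval (c • z) p = c ^ m * eval z p := by
  rw [eval_eq, eval_eq, Finset.mul_sum]
  refine Finset.sum_congr rfl fun d hd => ?_
  rw [hp.degree_eq_sum_deg_support hd]
  simp only [Pi.smul_apply, smul_eq_mul, mul_pow, Finset.prod_mul_distrib,
    Finset.prod_pow_eq_pow_sum]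
  ring

/-- Nonzero complex vectors whose nonzero entries lie in a common open half-plane through `0`. -/
def PointedHalfPlane {ι : Type*} (z : ι → ℂ) : Prop :=
  z ≠ 0 ∧ ∃ w : ℂ, ∀ i, z i = 0 ∨ 0 < (w * z i).re

/-- A complex polynomial without zeros on `PointedHalfPlane` vectors. -/
def StronglyStable {ι : Type*} (p : MvPolynomial ι ℂ) : Prop :=
  ∀ z, PointedHalfPlane z → MvPolynomial.eval z p ≠ 0

/-- The restriction of a polynomial to the line through `z` in the `j`-th coordinate direction. -/
noncomputable def lineRestriction {ι : Type*} [DecidableEq ι] (p : MvPolynomial ι ℂ) (z : ι → ℂ)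
    (j : ι) : Polynomial ℂ :=
  MvPolynomial.aeval (fun i => Polynomial.C ((Pi.single j 1 : ι → ℂ) i) * Polynomial.X +
    Polynomial.C (z i)) p

section LineRestriction

variable {ι : Type*} [DecidableEq ι] (p : MvPolynomial ι ℂ) (z : ι → ℂ) (j : ι)

lemma eval_lineRestriction (s : ℂ) :
    (lineRestriction p z j).eval s = MvPolynomial.eval (z + s • Pi.single j 1) p := by
  unfold lineRestriction
  induction p using MvPolynomial.induction_on with
  | C a => simp
  | add p q hp hq => simp [hp, hq]
  | mul_X p i hp =>
    simp only [map_mul, Polynomial.eval_mul, hp, MvPolynomial.aeval_X, MvPolynomial.eval_X]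
    simp; left; ring

lemma derivative_lineRestriction :
    (lineRestriction p z j).derivative = lineRestriction (MvPolynomial.pderiv j p) z j := by
  unfold lineRestriction
  induction p using MvPolynomial.induction_on with
  | C a => simp
  | add p q hp hq => simp [hp, hq]
  | mul_X p i hp =>
    rw [map_mul, Polynomial.derivative_mul, hp, MvPolynomial.pderiv_mul, map_add, map_mul, map_mul,
      MvPolynomial.pderiv_X, MvPolynomial.aeval_X]
    rcases eq_or_ne i j with rfl | h
    · simp
    · simp [Pi.single_eq_of_ne h]

variable {p} in
lemma natDegree_lineRestriction_le {m : ℕ} (hp : p.IsHomogeneous m) :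
    (lineRestriction p z j).natDegree ≤ m :=
  (MvPolynomial.aeval_natDegree_le p hp.totalDegree_le _
    fun _ => Polynomial.natDegree_linear_le).trans_eq (mul_one m)

end LineRestriction

/-- Slightly perturbing the half-plane witness moves any `s ≠ 0` on its boundary inside. -/
lemma PointedHalfPlane.exists_witness {ι : Type*} [Finite ι] {z : ι → ℂ} {w : ℂ}
    (hz : ∀ i, z i = 0 ∨ 0 < (w * z i).re) {s : ℂ} (hs : s ≠ 0) (hws : 0 ≤ (w * s).re) :
    ∃ w' : ℂ, (∀ i, z i = 0 ∨ 0 < (w' * z i).re) ∧ 0 < (w' * s).re := by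
  have key : ∀ᶠ ε : ℝ in nhdsWithin 0 (Set.Ioi 0),
      ∀ i, z i = 0 ∨ 0 < ((w + ε * (starRingEnd ℂ) s) * z i).re := by
    rw [Filter.eventually_all]
    intro i
    rcases hz i with h | h
    · exact Filter.Eventually.of_forall fun _ => Or.inl h
    · have hc : Continuous fun ε : ℝ => ((w + ε * (starRingEnd ℂ) s) * z i).re := by fun_prop
      have := hc.tendsto 0 |>.eventually (lt_mem_nhds (a := 0) (by simpa using h))
      exact Filter.Eventually.mono (nhdsWithin_le_nhds this) fun _ h => Or.inr h
  obtain ⟨ε, hε, hε0⟩ := (key.and self_mem_nhdsWithin).exists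
  refine ⟨_, hε, ?_⟩
  have : ((w + ε * (starRingEnd ℂ) s) * s).re = (w * s).re + ε * Complex.normSq s := by
    rw [add_mul, mul_assoc, mul_comm ((starRingEnd ℂ) s), Complex.mul_conj, ← Complex.ofReal_mul,
      Complex.add_re, Complex.ofReal_re]
  rw [this]
  have := mul_pos hε0 (Complex.normSq_pos.2 hs)
  linarith

section Stable

variable {ι : Type*} [DecidableEq ι]

lemma StronglyStable.re_root_neg [Finite ι] {p : MvPolynomial ι ℂ} (hp : StronglyStable p)
    {z : ι → ℂ} (hz0 : z ≠ 0) {w : ℂ} (hz : ∀ i, z i = 0 ∨ 0 < (w * z i).re) {j : ι} {s : ℂ}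
    (hs : (lineRestriction p z j).eval s = 0) : (w * s).re < 0 := by
  rw [eval_lineRestriction] at hs
  by_contra! hws
  have hs0 : s ≠ 0 := by
    rintro rfl
    exact hp z ⟨hz0, w, hz⟩ (by simpa using hs)
  obtain ⟨w', hw', hws'⟩ := PointedHalfPlane.exists_witness hz hs0 hws
  have hj : 0 < (w' * (z j + s)).re := by
    rw [mul_add, Complex.add_re]
    rcases hw' j with h | h
    · simpa [h] using hws'
    · positivity
  refine hp _ ⟨fun h => ?_, w', fun i => ?_⟩ hs
  · have := congrFun h j
    simp only [Pi.add_apply, Pi.smul_apply, Pi.single_eq_same, smul_eq_mul, mul_one,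
      Pi.zero_apply] at this
    simp [this] at hj
  · rcases eq_or_ne i j with rfl | h
    · right; simpa using hj
    · simpa [Pi.single_eq_of_ne h] using hw' i

lemma StronglyStable.roots_lineRestriction_ne_zero {p : MvPolynomial ι ℂ} (hp : StronglyStable p)
    {m : ℕ} (hm : p.IsHomogeneous (m + 1)) (z : ι → ℂ) (j : ι) :
    (lineRestriction p z j).roots ≠ 0 := by
  intro h
  have hconst := (IsAlgClosed.splits (lineRestriction p z j)).eq_prod_roots
  rw [h] at hconst
  set c := (lineRestriction p z j).leadingCoeff
  have hc : ∀ s : ℂ, MvPolynomial.eval (z + s • Pi.single j 1) p = c := fun s => by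
    rw [← eval_lineRestriction, hconst]; simp
  have hfun : ∀ t ∈ ({0}ᶜ : Set ℂ),
      MvPolynomial.eval (t • z + Pi.single j 1) p = t ^ (m + 1) * c := fun t ht => by
    rw [← hc t⁻¹, ← hm.eval_smul_pow, smul_add, smul_smul, mul_inv_cancel₀ ht, one_smul]
  have hcont : Continuous fun t : ℂ => MvPolynomial.eval (t • z + Pi.single j 1) p :=
    (MvPolynomial.continuous_eval p).comp (by fun_prop)
  have := congrFun (hcont.ext_on (dense_compl_singleton (0 : ℂ)) (by fun_prop) hfun) 0
  refine hp (Pi.single j 1) ⟨by simp, 1, fun i => ?_⟩ (by simpa using this)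
  rcases eq_or_ne i j with rfl | h
  · simp
  · simp [Pi.single_eq_of_ne h]

lemma StronglyStable.pderiv [Finite ι] {p : MvPolynomial ι ℂ} (hp : StronglyStable p)
    {m : ℕ} (hm : p.IsHomogeneous (m + 1)) (j : ι) : StronglyStable (MvPolynomial.pderiv j p) := by
  rintro z ⟨hz0, w, hz⟩ h0
  set R := lineRestriction p z j with hR
  have hR0 : R.eval 0 ≠ 0 := by
    simpa [hR, eval_lineRestriction] using hp z ⟨hz0, w, hz⟩
  have hlog := (IsAlgClosed.splits R).eval_derivative_div_eval_of_ne_zero hR0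
  rw [hR, derivative_lineRestriction, eval_lineRestriction] at hlog
  simp only [zero_smul, add_zero, h0, zero_div, zero_sub] at hlog
  have hpos : ∀ M : Multiset ℂ, (∀ s ∈ M, (w * s).re < 0) → M ≠ 0 →
      0 < ((starRingEnd ℂ) w * (M.map fun s => 1 / -s).sum).re := by
    have hterm : ∀ s : ℂ, (w * s).re < 0 → 0 < ((starRingEnd ℂ) w * (1 / -s)).re := fun s hs => by
      have hs0 : s ≠ 0 := by rintro rfl; simp at hs
      have hn := Complex.normSq_pos.2 hs0
      have : ((starRingEnd ℂ) w * (1 / -s)).re = -(w * s).re / Complex.normSq s := by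
        simp [Complex.inv_re, Complex.inv_im, Complex.mul_re]
        ring
      rw [this]
      exact div_pos (by linarith) hn
    intro M
    induction M using Multiset.induction_on with
    | empty => simp
    | cons a M ih =>
      intro h _
      rw [Multiset.map_cons, Multiset.sum_cons, mul_add, Complex.add_re]
      have ha := hterm a (h a (by simp))
      rcases eq_or_ne M 0 with rfl | hM
      · simpa using ha
      · exact add_pos ha (ih (fun s hs => h s (by simp [hs])) hM)
  have := hpos R.roots (fun s hs => hp.re_root_neg hz0 hz (Polynomial.isRoot_of_mem_roots hs))
    (hp.roots_lineRestriction_ne_zero hm z j)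
  rw [← hlog] at this
  simp at this

lemma Multiset.prod_one_add_mul_pow_card_le_exp {r : ℝ} (hr : 0 ≤ r) (M : Multiset ℝ)
    (hM : ∀ b ∈ M, 0 ≤ b) :
    (M.map (1 + ·)).prod * r ^ M.card ≤ Real.exp (r * (M.card + M.sum) - M.card) := by
  induction M using Multiset.induction_on with
  | empty => simp
  | cons a M ih =>
    have ih := ih fun b hb => hM b (Multiset.mem_cons_of_mem hb)
    have ha := hM a (Multiset.mem_cons_self a M)
    have h1 : (1 + a) * r ≤ Real.exp ((1 + a) * r - 1) := by
      have := Real.add_one_le_exp ((1 + a) * r - 1); linarith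
    have hprod : 0 ≤ (M.map (1 + ·)).prod :=
      Multiset.prod_nonneg fun x hx => by
        obtain ⟨b, hb, rfl⟩ := Multiset.mem_map.1 hx
        have := hM b (Multiset.mem_cons_of_mem hb)
        positivity
    simp only [Multiset.map_cons, Multiset.prod_cons, Multiset.card_cons, Multiset.sum_cons,
      Nat.cast_add, Nat.cast_one]
    calc _ = ((1 + a) * r) * ((M.map (1 + ·)).prod * r ^ M.card) := by ring
      _ ≤ Real.exp ((1 + a) * r - 1) * Real.exp (r * (M.card + M.sum) - M.card) := by gcongr
      _ = _ := by rw [← Real.exp_add]; congr 1; ring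

lemma Multiset.prod_one_add_mul_pow_le_one {m : ℕ} (hm : m ≠ 0) (M : Multiset ℝ)
    (hM : ∀ b ∈ M, 0 ≤ b) (hcard : M.card ≤ m + 1) (hsum : M.sum = (m + 1) / m) :
    (M.map (1 + ·)).prod * ((m : ℝ) / (m + 1)) ^ (m + 1) ≤ 1 := by
  have hm' : (m : ℝ) ≠ 0 := by exact_mod_cast hm
  obtain ⟨e, he⟩ := Nat.exists_eq_add_of_le hcard
  have he' : (m : ℝ) + 1 = M.card + e := by exact_mod_cast he
  set r : ℝ := (m : ℝ) / (m + 1) with hr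
  have hr0 : 0 ≤ r := by positivity
  have h1 := Multiset.prod_one_add_mul_pow_card_le_exp hr0 M hM
  have h2 : r ^ e ≤ Real.exp (e * (r - 1)) := by
    rw [Real.exp_nat_mul]
    gcongr
    have := Real.add_one_le_exp (r - 1); linarith
  calc _ = (M.map (1 + ·)).prod * r ^ M.card * r ^ e := by rw [he, pow_add]; ring
    _ ≤ Real.exp (r * (M.card + M.sum) - M.card) * Real.exp (e * (r - 1)) := by gcongr
    _ = Real.exp (r * (M.card + e) + r * M.sum - (M.card + e)) := by
      rw [← Real.exp_add]; congr 1; ring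
    _ = 1 := by
      rw [← he', hsum, hr, Real.exp_eq_one_iff]
      field_simp
      ring

/-- The capacity inequality for the derivative at `0` along a coordinate direction. -/
lemma StronglyStable.capacity_pderiv [Finite ι] {p : MvPolynomial ι ℂ} (hp : StronglyStable p)
    {m : ℕ} (hm0 : m ≠ 0) (hm : p.IsHomogeneous (m + 1)) {x : ι → ℝ} (hx0 : x ≠ 0)
    (hx : ∀ i, 0 ≤ x i) (j : ι) {c : ℝ}
    (hc : ∀ t : ℝ, 0 < t →
      c * t ≤ ‖MvPolynomial.eval ((fun i => (x i : ℂ)) + (t : ℂ) • Pi.single j 1) p‖) :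
    c * ((m : ℝ) / (m + 1)) ^ m ≤
      ‖MvPolynomial.eval (fun i => (x i : ℂ)) (MvPolynomial.pderiv j p)‖ := by
  set u : ι → ℂ := fun i => (x i : ℂ) with hu
  have hu0 : u ≠ 0 := fun h => hx0 <| by
    ext i
    simpa [hu] using congrFun h i
  have hhalf : ∀ w : ℂ, 0 < w.re → ∀ i, u i = 0 ∨ 0 < (w * u i).re := fun w hw i => by
    rcases (hx i).eq_or_lt with h | h
    · simp [hu, ← h]
    · right; simpa [hu] using mul_pos hw h
  set R := lineRestriction p u j with hR
  have hR0 : R.eval 0 ≠ 0 := by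
    simpa [hR, eval_lineRestriction] using hp u ⟨hu0, 1, hhalf 1 (by simp)⟩
  have hroot : ∀ s ∈ R.roots, s = -(‖s‖ : ℂ) ∧ 0 < ‖s‖ := fun s hs => by
    have hs := Polynomial.isRoot_of_mem_roots hs
    have hs0 : s ≠ 0 := by rintro rfl; exact hR0 hs
    refine ⟨?_, norm_pos_iff.2 hs0⟩
    have hle : s.re ≤ -‖s‖ := by
      by_contra! h
      have := hp.re_root_neg hu0 (hhalf (‖s‖ + (starRingEnd ℂ) s) (by simpa using by linarith)) hs
      have h2 : ((‖s‖ + (starRingEnd ℂ) s) * s).re = ‖s‖ * (s.re + ‖s‖) := by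
        rw [add_mul, mul_comm ((starRingEnd ℂ) s), Complex.mul_conj, Complex.normSq_eq_norm_sq,
          Complex.add_re, Complex.ofReal_re, Complex.re_ofReal_mul]
        ring
      rw [h2] at this
      exact absurd this (not_lt.2 (mul_nonneg (norm_nonneg _) (by linarith)))
    have hre : s.re = -‖s‖ := le_antisymm hle (neg_le_of_abs_le (Complex.abs_re_le_norm s))
    have him : s.im = 0 := by
      have := Complex.sq_norm_sub_sq_re s
      rw [hre] at this
      simpa using this.symm
    apply Complex.ext <;> simp [hre, him]
  have hRt : ∀ t : ℝ, 0 < t →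
      ‖R.eval (t : ℂ)‖ = ‖R.eval 0‖ * ((R.roots.map fun s => t * ‖s‖⁻¹).map (1 + ·)).prod := by
    intro t ht
    rw [(IsAlgClosed.splits R).eval_eq_prod_roots, (IsAlgClosed.splits R).eval_eq_prod_roots,
      norm_mul, norm_mul, mul_assoc]
    congr 1
    have hnorm : ∀ N : Multiset ℂ, ‖N.prod‖ = (N.map (‖·‖)).prod :=
      fun N => map_multiset_prod (normHom : ℂ →*₀ ℝ) N
    rw [hnorm, hnorm, Multiset.map_map, Multiset.map_map, Multiset.map_map, ← Multiset.prod_map_mul]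
    congr 1
    refine Multiset.map_congr rfl fun s hs => ?_
    obtain ⟨h1, h2⟩ := hroot s hs
    simp only [Function.comp_apply, zero_sub, norm_neg]
    rw [show (t : ℂ) - s = ((t + ‖s‖ : ℝ) : ℂ) by rw [h1]; simp, Complex.norm_real,
      Real.norm_of_nonneg (by positivity)]
    field_simp
    ring
  set B : ℝ := (R.roots.map fun s => ‖s‖⁻¹).sum with hB
  have hderiv : ‖MvPolynomial.eval u (MvPolynomial.pderiv j p)‖ = ‖R.eval 0‖ * B := by
    have h1 : MvPolynomial.eval u (MvPolynomial.pderiv j p) = R.derivative.eval 0 := by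
      rw [hR, derivative_lineRestriction, eval_lineRestriction]; simp
    have h2 : (R.roots.map fun s => 1 / (0 - s)).sum = ((B : ℝ) : ℂ) := by
      rw [hB, ← Complex.ofRealHom_eq_coe, map_multiset_sum, Multiset.map_map]
      congr 1
      refine Multiset.map_congr rfl fun s hs => ?_
      conv_lhs => rw [(hroot s hs).1]
      simp
    have hB0 : 0 ≤ B := Multiset.sum_nonneg fun y hy => by
      obtain ⟨s, _, rfl⟩ := Multiset.mem_map.1 hy
      positivity
    rw [h1, (IsAlgClosed.splits R).eval_derivative_eq_eval_mul_sum hR0, h2, norm_mul,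
      Complex.norm_real, Real.norm_of_nonneg hB0]
  have hBpos : 0 < B := by
    obtain ⟨s, hs⟩ := Multiset.exists_mem_of_ne_zero (hp.roots_lineRestriction_ne_zero hm u j)
    refine (inv_pos.2 (hroot s hs).2).trans_le (Multiset.single_le_sum (fun y hy => ?_) _
      (Multiset.mem_map_of_mem _ hs))
    obtain ⟨s, _, rfl⟩ := Multiset.mem_map.1 hy
    positivity
  have hmpos : (0 : ℝ) < m := by exact_mod_cast Nat.pos_of_ne_zero hm0
  set t : ℝ := (m + 1) / m * B⁻¹ with ht
  have htpos : 0 < t := by positivity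
  have hub := Multiset.prod_one_add_mul_pow_le_one hm0 (R.roots.map fun s => t * ‖s‖⁻¹)
    (fun b hb => by
      obtain ⟨s, _, rfl⟩ := Multiset.mem_map.1 hb
      positivity)
    (by
      rw [Multiset.card_map]
      exact R.card_roots'.trans (natDegree_lineRestriction_le u j hm))
    (by rw [Multiset.sum_map_mul_left, ← hB, ht]; field_simp)
  have hlow := hc t htpos
  rw [← eval_lineRestriction, ← hR, hRt t htpos] at hlow
  set r : ℝ := (m : ℝ) / (m + 1) with hr
  have hrpos : 0 < r := by positivity
  have h3 : c * t * r ^ (m + 1) ≤ ‖R.eval 0‖ := by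
    calc c * t * r ^ (m + 1) ≤ ‖R.eval 0‖ *
          ((R.roots.map fun s => t * ‖s‖⁻¹).map (1 + ·)).prod * r ^ (m + 1) := by gcongr
      _ = ‖R.eval 0‖ * (((R.roots.map fun s => t * ‖s‖⁻¹).map (1 + ·)).prod * r ^ (m + 1)) := by
        ring
      _ ≤ ‖R.eval 0‖ * 1 := by gcongr
      _ = _ := mul_one _
  have h4 : t * r = B⁻¹ := by rw [ht, hr]; field_simp
  rw [hderiv]
  calc c * r ^ m = c * (t * r) * r ^ m * B := by rw [h4]; field_simp
    _ = c * t * r ^ (m + 1) * B := by ring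
    _ ≤ _ := by gcongr

end Stable

section VanDerWaerden

variable {ι : Type*}

/-- A lower bound for the squarefree coefficient of a stable homogeneous polynomial in terms of
its capacity. -/
theorem StronglyStable.capacity_le_norm_coeff [DecidableEq ι] [Fintype ι] (S : Finset ι)
    {p : MvPolynomial ι ℂ} (hp : StronglyStable p) (hm : p.IsHomogeneous S.card) {c : ℝ}
    (hc : ∀ x : ι → ℝ, (∀ i ∈ S, 0 < x i) → (∀ i ∉ S, x i = 0) →
      c * ∏ i ∈ S, x i ≤ ‖MvPolynomial.eval (fun i => (x i : ℂ)) p‖) :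
    c * (S.card.factorial / (S.card : ℝ) ^ S.card) ≤
      ‖MvPolynomial.coeff (∑ i ∈ S, Finsupp.single i 1) p‖ := by
  induction S using Finset.induction_on generalizing p c with
  | empty =>
    have := hc 0 (by simp) (by simp)
    have h0 : (fun i : ι => (((0 : ι → ℝ) i : ℝ) : ℂ)) = 0 := by ext; simp
    rw [h0, MvPolynomial.eval_zero, MvPolynomial.constantCoeff_eq] at this
    simpa using this
  | insert j S hj ih =>
    rw [Finset.card_insert_of_notMem hj] at hm ⊢
    set m := S.card with hmdef
    have hcoeff : MvPolynomial.coeff (∑ i ∈ insert j S, Finsupp.single i 1) p =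
        MvPolynomial.coeff (∑ i ∈ S, Finsupp.single i 1) (MvPolynomial.pderiv j p) := by
      have : (∑ i ∈ S, Finsupp.single i 1 : ι →₀ ℕ) j = 0 := by
        rw [Finsupp.finsetSum_apply]
        exact Finset.sum_eq_zero fun i hi =>
          Finsupp.single_eq_of_ne (by rintro rfl; exact hj hi)
      rw [MvPolynomial.coeff_pderiv, Finset.sum_insert hj, this, add_comm]
      simp
    have hpd : (MvPolynomial.pderiv j p).IsHomogeneous m := hm.pderiv
    have hstep : c * ((m : ℝ) / (m + 1)) ^ m * (m.factorial / (m : ℝ) ^ m) ≤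
        ‖MvPolynomial.coeff (∑ i ∈ S, Finsupp.single i 1) (MvPolynomial.pderiv j p)‖ := by
      refine ih (hp.pderiv hm j) hpd fun x hxpos hx0 => ?_
      have hprod : 0 < ∏ i ∈ S, x i := Finset.prod_pos hxpos
      have hline : ∀ t : ℝ, 0 < t → c * (∏ i ∈ S, x i) * t ≤
          ‖MvPolynomial.eval ((fun i => (x i : ℂ)) + (t : ℂ) • Pi.single j 1) p‖ := by
        intro t ht
        have := hc (Function.update x j t)
          (fun i hi => by
            rcases eq_or_ne i j with rfl | h
            · simpa using ht
            · simpa [h] using hxpos i (Finset.mem_of_mem_insert_of_ne hi h))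
          (fun i hi => by
            rw [Finset.mem_insert, not_or] at hi
            simpa [hi.1] using hx0 i hi.2)
        rw [Finset.prod_insert hj, Function.update_self, Finset.prod_congr rfl
          (fun i hi => Function.update_of_ne (by rintro rfl; exact hj hi) t x)] at this
        have hfun : (fun i => ((Function.update x j t i : ℝ) : ℂ)) =
            (fun i => (x i : ℂ)) + (t : ℂ) • Pi.single j 1 := by
          ext i
          rcases eq_or_ne i j with rfl | h
          · simp [hx0 i hj]
          · simp [h]
        rw [hfun] at this
        linarith
      rcases S.eq_empty_or_nonempty with rfl | ⟨k, hk⟩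
      · have hm0 : m = 0 := by simp [hmdef]
        have hx : (fun i => (x i : ℂ)) = 0 := by
          ext i; simp [hx0 i]
        have h1 := hline 1 one_pos
        rw [hx] at h1 ⊢
        have heuler := congrArg (MvPolynomial.eval (Pi.single j 1 : ι → ℂ)) hm.sum_X_mul_pderiv
        rw [map_sum, Finset.sum_eq_single j
          (fun i _ hi => by simp [Pi.single_eq_of_ne hi]) (by simp)] at heuler
        rw [hm0] at hpd
        have hC := MvPolynomial.totalDegree_eq_zero_iff_eq_C.1
          ((MvPolynomial.totalDegree_zero_iff_isHomogeneous ι).2 hpd)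
        rw [hC] at heuler ⊢
        simp [hm0] at heuler h1 ⊢
        rw [heuler]
        linarith
      · have hm0 : m ≠ 0 := Finset.card_ne_zero_of_mem hk
        have := hp.capacity_pderiv hm0 hm (x := x)
          (fun h => (hxpos k hk).ne' (congrFun h k))
          (fun i => by
            by_cases hi : i ∈ S
            · exact (hxpos i hi).le
            · exact (hx0 i hi).ge) j hline
        linarith
    rw [hcoeff]
    refine le_trans (le_of_eq ?_) hstep
    have hmm : (m : ℝ) ^ m ≠ 0 := by
      rcases Nat.eq_zero_or_pos m with h | h
      · simp [h]
      · positivity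
    rw [Nat.factorial_succ, div_pow]
    push_cast
    field_simp
    ring

variable [Fintype ι]

/-- The product of the linear forms given by the rows of a matrix. -/
noncomputable def rowFormProd (A : Matrix ι ι ℝ) : MvPolynomial ι ℂ :=
  ∏ i, ∑ j, MvPolynomial.C (A i j : ℂ) * MvPolynomial.X j

lemma isHomogeneous_rowFormProd (A : Matrix ι ι ℝ) :
    (rowFormProd A).IsHomogeneous (Fintype.card ι) := by
  have := MvPolynomial.IsHomogeneous.prod Finset.univ
    (fun i => ∑ j, MvPolynomial.C (A i j : ℂ) * MvPolynomial.X j) (fun _ => 1)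
    fun i _ => MvPolynomial.IsHomogeneous.sum _ _ 1
      fun j _ => MvPolynomial.isHomogeneous_C_mul_X _ _
  simpa [rowFormProd] using this

lemma eval_rowFormProd (A : Matrix ι ι ℝ) (z : ι → ℂ) :
    MvPolynomial.eval z (rowFormProd A) = ∏ i, ∑ j, (A i j : ℂ) * z j := by
  simp [rowFormProd, map_prod, map_sum]

lemma stronglyStable_rowFormProd {A : Matrix ι ι ℝ} (hA : ∀ i j, 0 < A i j) :
    StronglyStable (rowFormProd A) := by
  rintro z ⟨hz0, w, hz⟩
  rw [eval_rowFormProd]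
  refine Finset.prod_ne_zero_iff.2 fun i _ h => ?_
  obtain ⟨k, hk⟩ := Function.ne_iff.1 hz0
  have hre : ∀ j, (w * ((A i j : ℂ) * z j)).re = A i j * (w * z j).re := fun j => by
    rw [mul_left_comm, Complex.re_ofReal_mul]
  have hpos : 0 < ∑ j, (w * ((A i j : ℂ) * z j)).re := by
    refine Finset.sum_pos' (fun j _ => ?_) ⟨k, Finset.mem_univ k, ?_⟩
    · rw [hre]
      rcases hz j with h | h
      · simp [h]
      · exact (mul_pos (hA i j) h).le
    · rw [hre]
      exact mul_pos (hA i k) ((hz k).resolve_left hk)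
  rw [← Complex.re_sum, ← Finset.mul_sum, h] at hpos
  simp at hpos

variable [DecidableEq ι]

lemma coeff_rowFormProd (A : Matrix ι ι ℝ) :
    MvPolynomial.coeff (∑ i, Finsupp.single i 1) (rowFormProd A) = (A.permanent : ℂ) := by
  have hexp : rowFormProd A = ∑ f : ι → ι,
      MvPolynomial.monomial (∑ i, Finsupp.single (f i) 1) (∏ i, (A i (f i) : ℂ)) := by
    rw [rowFormProd, Finset.prod_univ_sum, Fintype.piFinset_univ]
    refine Finset.sum_congr rfl fun f _ => ?_
    rw [MvPolynomial.monomial_sum_prod]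
    exact Finset.prod_congr rfl fun i _ => MvPolynomial.C_mul_X_eq_monomial
  rw [hexp, MvPolynomial.coeff_sum, ← Matrix.permanent_transpose, Matrix.permanent]
  push_cast
  symm
  refine Finset.sum_of_injOn (fun σ : Equiv.Perm ι => (σ : ι → ι))
    (fun σ _ τ _ h => DFunLike.coe_injective h) (fun _ _ => by simp) (fun f _ hf => ?_)
    (fun σ _ => ?_)
  · rw [MvPolynomial.coeff_monomial, if_neg]
    intro h
    have hsurj : Function.Surjective f := fun k => by
      by_contra! hk
      have := DFunLike.congr_fun h k
      rw [Finsupp.finsetSum_apply, Finsupp.finsetSum_apply, Finset.sum_eq_zero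
        (fun i _ => Finsupp.single_eq_of_ne (hk i).symm), Finset.sum_eq_single k
        (fun i _ hi => Finsupp.single_eq_of_ne hi.symm) (by simp)] at this
      simp at this
    exact hf ⟨Equiv.ofBijective f ⟨Finite.injective_iff_surjective.2 hsurj, hsurj⟩, by simp, rfl⟩
  · rw [MvPolynomial.coeff_monomial,
      if_pos (Equiv.sum_comp σ fun i => (Finsupp.single i 1 : ι →₀ ℕ))]
    rfl

/-- The capacity of the product of row forms of a doubly stochastic matrix is at least `1`. -/
lemma prod_le_prod_mulVec {A : Matrix ι ι ℝ} (hA : A ∈ doublyStochastic ℝ ι) {x : ι → ℝ}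
    (hx : ∀ i, 0 < x i) : ∏ i, x i ≤ ∏ i, ∑ j, A i j * x j := by
  calc ∏ j, x j = ∏ j, x j ^ (∑ i, A i j) := by
        simp [sum_col_of_mem_doublyStochastic hA]
    _ = ∏ j, ∏ i, x j ^ A i j := Finset.prod_congr rfl fun j _ => Real.rpow_sum_of_pos (hx j) _ _
    _ = ∏ i, ∏ j, x j ^ A i j := Finset.prod_comm
    _ ≤ ∏ i, ∑ j, A i j * x j := by
        refine Finset.prod_le_prod
          (fun i _ => Finset.prod_nonneg fun j _ => Real.rpow_nonneg (hx j).le _) fun i _ => ?_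
        exact Real.geom_mean_le_arith_mean_weighted _ _ _
          (fun j _ => nonneg_of_mem_doublyStochastic hA) (sum_row_of_mem_doublyStochastic hA i)
          (fun j _ => (hx j).le)

lemma permanent_lower_bound_of_pos {A : Matrix ι ι ℝ} (hA : A ∈ doublyStochastic ℝ ι)
    (hpos : ∀ i j, 0 < A i j) :
    ((Fintype.card ι).factorial : ℝ) / (Fintype.card ι : ℝ) ^ Fintype.card ι ≤ A.permanent := by
  have h := (stronglyStable_rowFormProd hpos).capacity_le_norm_coeff Finset.univ (c := 1)
    (isHomogeneous_rowFormProd A) (fun x hx _ => by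
      rw [eval_rowFormProd, one_mul]
      have h1 : (∏ i, ∑ j, (A i j : ℂ) * (x j : ℂ)) = ((∏ i, ∑ j, A i j * x j : ℝ) : ℂ) := by
        push_cast; rfl
      rw [h1, Complex.norm_real]
      exact (prod_le_prod_mulVec hA fun i => hx i (Finset.mem_univ i)).trans (le_abs_self _))
  have hper : 0 ≤ A.permanent :=
    Finset.sum_nonneg fun σ _ => Finset.prod_nonneg fun i _ => (hpos _ _).le
  rwa [coeff_rowFormProd, Complex.norm_real, Real.norm_of_nonneg hper, one_mul,
    Finset.card_univ] at h

/-- **Van der Waerden's permanent inequality**: the permanent of a doubly stochastic matrix of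
order `n` is at least `n! / n ^ n`. -/
theorem permanent_lower_bound {A : Matrix ι ι ℝ} (hA : A ∈ doublyStochastic ℝ ι) :
    ((Fintype.card ι).factorial : ℝ) / (Fintype.card ι : ℝ) ^ Fintype.card ι ≤ A.permanent := by
  rcases isEmpty_or_nonempty ι with _ | _
  · simp [Matrix.permanent_isEmpty]
  have hn : (0 : ℝ) < Fintype.card ι := by exact_mod_cast Fintype.card_pos
  set J : Matrix ι ι ℝ := Matrix.of fun _ _ => (Fintype.card ι : ℝ)⁻¹ with hJ
  have hJmem : J ∈ doublyStochastic ℝ ι := by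
    rw [mem_doublyStochastic_iff_sum]
    refine ⟨fun _ _ => by simp [hJ], fun _ => ?_, fun _ => ?_⟩ <;> simp [hJ, hn.ne']
  have hcont : Continuous fun t : ℝ => ((1 - t) • A + t • J).permanent := by
    simp only [Matrix.permanent, Matrix.add_apply, Matrix.smul_apply, smul_eq_mul]
    fun_prop
  have htend : Filter.Tendsto (fun t : ℝ => ((1 - t) • A + t • J).permanent)
      (nhdsWithin 0 (Set.Ioi 0)) (nhds A.permanent) := by
    have := hcont.tendsto 0
    simp only [sub_zero, one_smul, zero_smul, add_zero] at this
    exact this.mono_left nhdsWithin_le_nhds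
  refine ge_of_tendsto htend ?_
  filter_upwards [Ioo_mem_nhdsGT (zero_lt_one (α := ℝ))] with t ht
  refine permanent_lower_bound_of_pos
    (convex_doublyStochastic hA hJmem (by linarith [ht.2]) ht.1.le (by ring)) fun i j => ?_
  simp only [Matrix.add_apply, Matrix.smul_apply, smul_eq_mul]
  have h1 : 0 ≤ (1 - t) * A i j :=
    mul_nonneg (by linarith [ht.2]) (nonneg_of_mem_doublyStochastic hA)
  have h2 : 0 < t * J i j := mul_pos ht.1 (by simpa [hJ] using hn)
  linarith

end VanDerWaerden

section ChebyshevBall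

lemma chebDist_le_iff {n D : ℕ} {π σ : Equiv.Perm (Fin n)} :
    chebDist π σ ≤ D ↔ ∀ i, Nat.dist (π i) (σ i) ≤ D := by
  simp [chebDist]

/-- The band matrix of half-width `D`, with the corners `i + j < m` and their mirror images
counted twice. -/
def cornerBand (n D m : ℕ) : Matrix (Fin n) (Fin n) ℝ := Matrix.of fun i j =>
  (if Nat.dist (i : ℕ) j ≤ D then 1 else 0) + (if (i : ℕ) + j + 1 ≤ m then 1 else 0) +
    (if 2 * n ≤ (i : ℕ) + j + 1 + m then 1 else 0)

lemma cornerBand_comm (n D m : ℕ) (i j : Fin n) : cornerBand n D m i j = cornerBand n D m j i := by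
  simp only [cornerBand, Matrix.of_apply, Nat.dist_comm (i : ℕ), add_comm (i : ℕ)]

lemma Fin.sum_boole_eq_sub {n a b : ℕ} (hb : b ≤ n) (P : ℕ → Prop) [DecidablePred P]
    (hP : ∀ j < n, P j ↔ a ≤ j ∧ j < b) :
    ∑ j : Fin n, (if P j then (1 : ℝ) else 0) = ((b - a : ℕ) : ℝ) := by
  rw [Fin.sum_univ_eq_sum_range fun j => if P j then (1 : ℝ) else 0, Finset.sum_boole,
    ← Nat.card_Ico]
  congr 2
  ext j
  simp only [Finset.mem_filter, Finset.mem_range, Finset.mem_Ico]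
  constructor
  · rintro ⟨h1, h2⟩; exact (hP j h1).1 h2
  · rintro ⟨h1, h2⟩; exact ⟨by omega, (hP j (by omega)).2 ⟨h1, h2⟩⟩

lemma sum_cornerBand {n D m : ℕ} (hD : D < n) (hm : m = min D (n - 1 - D)) (i : Fin n) :
    ∑ j, cornerBand n D m i j = D + m + 1 := by
  have hi := i.2
  simp only [cornerBand, Matrix.of_apply, Finset.sum_add_distrib]
  rw [Fin.sum_boole_eq_sub (a := i - D) (b := min n (i + D + 1)) (by omega)
      (fun j => Nat.dist i j ≤ D) (fun j hj => by unfold Nat.dist; omega),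
    Fin.sum_boole_eq_sub (a := 0) (b := m - i) (by omega)
      (fun j => i + j + 1 ≤ m) (fun j hj => by omega),
    Fin.sum_boole_eq_sub (a := 2 * n - (i + 1 + m)) (b := n) le_rfl
      (fun j => 2 * n ≤ i + j + 1 + m) (fun j hj => by omega)]
  norm_cast
  omega

/-- The permanent bound for the Chebyshev ball. -/
lemma chebBall_lower_bound {n D m : ℕ} (hD : D < n) (hm : m = min D (n - 1 - D)) :
    ((D : ℝ) + m + 1) ^ n * (n.factorial / (n : ℝ) ^ n) ≤ 2 ^ (2 * m) * (chebBall n D : ℝ) := by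
  have hr : (0 : ℝ) < D + m + 1 := by positivity
  have hB0 : ∀ i j, 0 ≤ cornerBand n D m i j := fun i j => by
    simp only [cornerBand, Matrix.of_apply]; positivity
  have hmem : ((D : ℝ) + m + 1)⁻¹ • cornerBand n D m ∈ doublyStochastic ℝ (Fin n) := by
    rw [mem_doublyStochastic_iff_sum]
    refine ⟨fun i j => ?_, fun i => ?_, fun j => ?_⟩
    · exact mul_nonneg (inv_nonneg.2 hr.le) (hB0 i j)
    · simp only [Matrix.smul_apply, smul_eq_mul, ← Finset.mul_sum, sum_cornerBand hD hm]
      exact inv_mul_cancel₀ hr.ne'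
    · simp only [Matrix.smul_apply, smul_eq_mul, ← Finset.mul_sum]
      simp only [cornerBand_comm n D m _ j, sum_cornerBand hD hm]
      exact inv_mul_cancel₀ hr.ne'
  have hvdw := permanent_lower_bound hmem
  rw [Matrix.permanent_smul, Fintype.card_fin, inv_pow, inv_mul_eq_div,
    le_div_iff₀' (pow_pos hr n)] at hvdw
  refine hvdw.trans ?_
  rw [Matrix.permanent, chebBall, ← Finset.sum_filter_add_sum_filter_not _
    (fun σ : Equiv.Perm (Fin n) => chebDist σ 1 ≤ D), mul_comm (2 ^ (2 * m) : ℝ),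
    ← nsmul_eq_mul, ← Finset.sum_const]
  have hzero : ∑ σ : Equiv.Perm (Fin n) with ¬ chebDist σ 1 ≤ D,
      ∏ i, cornerBand n D m (σ i) i = 0 := by
    refine Finset.sum_eq_zero fun σ hσ => ?_
    rw [Finset.mem_filter, chebDist_le_iff] at hσ
    push Not at hσ
    obtain ⟨-, i, hi⟩ := hσ
    refine Finset.prod_eq_zero (Finset.mem_univ i) ?_
    have h1 := (σ i).2
    have h2 := i.2
    simp only [Equiv.Perm.coe_one, id_eq] at hi
    rw [cornerBand, Matrix.of_apply, if_neg (by omega), if_neg (by unfold Nat.dist at hi; omega),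
      if_neg (by unfold Nat.dist at hi; omega)]
    simp
  rw [hzero, add_zero]
  refine Finset.sum_le_sum fun σ _ => ?_
  set T : Finset (Fin n) := {i | (i : ℕ) < m ∨ n ≤ i + m} with hT
  have hTcard : T.card ≤ 2 * m := by
    have : T.card ≤ (Finset.range m ∪ Finset.Ico (n - m) n).card := by
      refine Finset.card_le_card_of_injOn (fun i : Fin n => (i : ℕ)) (fun i hi => ?_)
        (fun i _ j _ h => Fin.ext h)
      have hi' : (i : ℕ) < m ∨ n ≤ i + m := by simpa [hT] using hi
      have := i.2
      simp only [Finset.coe_union, Finset.coe_range, Finset.coe_Ico, Set.mem_union, Set.mem_Iio,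
        Set.mem_Ico]
      omega
    refine this.trans ((Finset.card_union_le _ _).trans ?_)
    rw [Finset.card_range, Nat.card_Ico]
    omega
  calc ∏ i, cornerBand n D m (σ i) i ≤ ∏ i, (if i ∈ T then (2 : ℝ) else 1) := by
        refine Finset.prod_le_prod (fun i _ => hB0 _ _) fun i _ => ?_
        have h1 := (σ i).2
        have h2 := i.2
        simp only [cornerBand, Matrix.of_apply, hT, Finset.mem_filter, Finset.mem_univ, true_and]
        split_ifs <;> first | omega | norm_num
    _ = 2 ^ T.card := by rw [Finset.prod_ite_mem, Finset.univ_inter, Finset.prod_const]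
    _ ≤ 2 ^ (2 * m) := pow_le_pow_right₀ one_le_two hTcard

lemma card_chebDist_le (n D : ℕ) (π : Equiv.Perm (Fin n)) :
    (Finset.univ.filter fun σ : Equiv.Perm (Fin n) => chebDist π σ ≤ D).card = chebBall n D := by
  refine Finset.card_bij' (fun σ _ => σ * π⁻¹) (fun τ _ => τ * π) ?_ ?_ (by simp) (by simp)
  · intro σ hσ
    simp only [Finset.mem_filter, Finset.mem_univ, true_and, chebDist_le_iff] at hσ ⊢
    intro i
    have := hσ (π⁻¹ i)
    rw [Nat.dist_comm] at this
    simpa using this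
  · intro τ hτ
    simp only [Finset.mem_filter, Finset.mem_univ, true_and, chebDist_le_iff] at hτ ⊢
    intro i
    have := hτ (π i)
    rw [Nat.dist_comm] at this
    simpa using this

end ChebyshevBall

/-- A random set of `N ≥ log |G| / (V / |G|)` points covers `G` when every point is covered by at
least `V` points. -/
lemma exists_covering_finset {G : Type*} [Fintype G] [DecidableEq G] [Nonempty G]
    (r : G → G → Prop) [∀ a, DecidablePred (r a)] {V N : ℕ} (hV : 0 < V) (hN : 0 < N)
    (hr : ∀ a, V ≤ (Finset.univ.filter (r a)).card)
    (hVN : Real.log (Fintype.card G) * Fintype.card G ≤ V * N) :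
    ∃ C : Finset G, C.card ≤ N ∧ ∀ a, ∃ b ∈ C, r a b := by
  set g : ℝ := (Fintype.card G : ℝ) with hg
  have hg0 : 0 < g := by rw [hg]; exact_mod_cast Fintype.card_pos
  let bad : G → Finset (Fin N → G) := fun a =>
    Fintype.piFinset fun _ => Finset.univ.filter fun b => ¬ r a b
  have hbad : ∀ a, ((bad a).card : ℝ) < g ^ N / g := fun a => by
    have hcompl := Finset.card_filter_add_card_filter_not (s := Finset.univ) (r a)
    rw [Finset.card_univ] at hcompl
    have hcompl' : ((Finset.univ.filter (r a)).card : ℝ) +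
        (Finset.univ.filter fun b => ¬ r a b).card = g := by rw [hg]; exact_mod_cast hcompl
    have hra : (V : ℝ) ≤ (Finset.univ.filter (r a)).card := by exact_mod_cast hr a
    have hV' : (0 : ℝ) < V := by exact_mod_cast hV
    have hlt : ((Finset.univ.filter fun b => ¬ r a b).card : ℝ) < g * Real.exp (-(V / g)) := by
      have h1 := Real.add_one_lt_exp (x := -(V / g)) (neg_ne_zero.2 (by positivity))
      have h2 : g * (-(V / g) + 1) = g - V := by field_simp; ring
      have h3 := mul_lt_mul_of_pos_left h1 hg0
      linarith
    have hexp : Real.exp (-(V / g)) ^ N ≤ g⁻¹ := by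
      rw [← Real.exp_nat_mul, ← Real.exp_log (inv_pos.2 hg0), Real.log_inv]
      refine Real.exp_le_exp.2 ?_
      have : Real.log g ≤ V * N / g := (le_div_iff₀ hg0).2 hVN
      have h2 : (N : ℝ) * -(V / g) = -(V * N / g) := by ring
      linarith
    rw [Fintype.card_piFinset_const, Nat.cast_pow]
    calc _ < (g * Real.exp (-(V / g))) ^ N := pow_lt_pow_left₀ hlt (by positivity) hN.ne'
      _ = g ^ N * Real.exp (-(V / g)) ^ N := mul_pow _ _ _
      _ ≤ g ^ N * g⁻¹ := by gcongr
      _ = _ := (div_eq_mul_inv _ _).symm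
  have hunion : (Finset.univ.biUnion bad).card < Fintype.card (Fin N → G) := by
    have h1 : ((Finset.univ.biUnion bad).card : ℝ) ≤ ∑ a, ((bad a).card : ℝ) := by
      exact_mod_cast Finset.card_biUnion_le
    have h2 : ∑ a, ((bad a).card : ℝ) < ∑ _a : G, g ^ N / g :=
      Finset.sum_lt_sum_of_nonempty Finset.univ_nonempty fun a _ => hbad a
    rw [Finset.sum_const, Finset.card_univ, nsmul_eq_mul, ← hg, mul_div_cancel₀ _ hg0.ne'] at h2
    have h3 := h1.trans_lt h2
    rw [hg] at h3
    rw [Fintype.card_fun, Fintype.card_fin]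
    exact_mod_cast h3
  obtain ⟨f, -, hf⟩ := Finset.exists_mem_notMem_of_card_lt_card
    (hunion.trans_eq Finset.card_univ.symm)
  refine ⟨Finset.univ.image f, Finset.card_image_le.trans (by simp), fun a => ?_⟩
  by_contra! h
  refine hf (Finset.mem_biUnion.2 ⟨a, Finset.mem_univ a, Fintype.mem_piFinset.2 fun i => ?_⟩)
  simpa using h (f i) (by simp)

/-- A covering code of size `⌈L⌉` exists as soon as `L` is at least `ln(n!) · n! / |B|`. -/
lemma exists_chebyshev_covering_code {n D : ℕ} (hn : 2 ≤ n) {L : ℝ}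
    (hL : Real.log n.factorial * n.factorial ≤ chebBall n D * L) :
    ∃ C : Finset (Equiv.Perm (Fin n)), (C.card : ℤ) ≤ ⌈L⌉ ∧
      ∀ π : Equiv.Perm (Fin n), ∃ σ ∈ C, chebDist π σ ≤ D := by
  have hfact : 1 < (n.factorial : ℝ) := by exact_mod_cast Nat.one_lt_factorial.2 hn
  have hpos : 0 < (chebBall n D : ℝ) * L :=
    (mul_pos (Real.log_pos hfact) (by linarith)).trans_le hL
  have hV : 0 < chebBall n D := Nat.pos_of_ne_zero fun h => by simp [h] at hpos
  have hL0 : 0 < L := pos_of_mul_pos_right hpos (Nat.cast_nonneg _)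
  have hceil : 0 < ⌈L⌉ := Int.ceil_pos.2 hL0
  have hLN : L ≤ (⌈L⌉.toNat : ℝ) := by
    have h1 : ((⌈L⌉.toNat : ℤ) : ℝ) = (⌈L⌉ : ℝ) := by rw [Int.toNat_of_nonneg hceil.le]
    rw [Int.cast_natCast] at h1
    rw [h1]
    exact Int.le_ceil L
  obtain ⟨C, hC, hcov⟩ := exists_covering_finset
    (fun π σ : Equiv.Perm (Fin n) => chebDist π σ ≤ D) (N := ⌈L⌉.toNat) hV (by omega)
    (fun π => (card_chebDist_le n D π).ge)
    (by
      rw [Fintype.card_perm, Fintype.card_fin]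
      exact hL.trans (by gcongr))
  exact ⟨C, by omega, hcov⟩

/-- Covering codes for the Chebyshev metric: for `D ≤ (n-1)/2` there is one of size at most
`⌈ln(n!)·2^(2D)·n^n/(2D+1)^n⌉`, and for `(n-1)/2 ≤ D ≤ n-1` one of size at most
`⌈ln(n!)·2^(2(n-D))⌉`. -/
theorem stmt_19 (n D : ℕ) (hn : 2 ≤ n) (hD : 1 ≤ D) :
    ((D : ℝ) ≤ ((n : ℝ) - 1) / 2 →
      ∃ C : Finset (Equiv.Perm (Fin n)),
        (C.card : ℤ) ≤ ⌈Real.log (n.factorial : ℝ) * 2 ^ (2 * D) * (n : ℝ) ^ n /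
          (2 * (D : ℝ) + 1) ^ n⌉ ∧
        ∀ π : Equiv.Perm (Fin n), ∃ σ ∈ C, chebDist π σ ≤ D) ∧
    (((n : ℝ) - 1) / 2 ≤ (D : ℝ) → D ≤ n - 1 →
      ∃ C : Finset (Equiv.Perm (Fin n)),
        (C.card : ℤ) ≤ ⌈Real.log (n.factorial : ℝ) * 2 ^ (2 * (n - D))⌉ ∧
        ∀ π : Equiv.Perm (Fin n), ∃ σ ∈ C, chebDist π σ ≤ D) := by
  have hlog : 0 ≤ Real.log (n.factorial : ℝ) := Real.log_natCast_nonneg _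
  have hn0 : (0 : ℝ) < (n : ℝ) ^ n := by positivity
  refine ⟨fun h => ?_, fun h hDn => ?_⟩
  · have hD2 : 2 * D + 1 ≤ n := by
      have : 2 * (D : ℝ) + 1 ≤ n := by linarith
      exact_mod_cast this
    have hball := chebBall_lower_bound (n := n) (D := D) (m := D) (by omega) (by omega)
    rw [← two_mul, mul_div_assoc', div_le_iff₀ hn0] at hball
    refine exists_chebyshev_covering_code hn ?_
    rw [mul_div_assoc', le_div_iff₀ (by positivity)]
    calc _ = Real.log n.factorial * ((2 * (D : ℝ) + 1) ^ n * n.factorial) := by ring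
      _ ≤ Real.log n.factorial * (2 ^ (2 * D) * (chebBall n D : ℝ) * (n : ℝ) ^ n) := by gcongr
      _ = _ := by ring
  · have hD2 : n ≤ 2 * D + 1 := by
      have : (n : ℝ) ≤ 2 * D + 1 := by linarith
      exact_mod_cast this
    have hball := chebBall_lower_bound (n := n) (D := D) (m := n - 1 - D) (by omega) (by omega)
    have hr : (D : ℝ) + (n - 1 - D : ℕ) + 1 = n := by
      norm_cast
      omega
    rw [hr, mul_div_cancel₀ _ hn0.ne'] at hball
    refine exists_chebyshev_covering_code hn ?_
    have hpow : (2 : ℝ) ^ (2 * (n - 1 - D)) ≤ 2 ^ (2 * (n - D)) :=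
      pow_le_pow_right₀ one_le_two (by omega)
    calc _ ≤ Real.log n.factorial * (2 ^ (2 * (n - D)) * (chebBall n D : ℝ)) := by
          gcongr
          exact hball.trans (by gcongr)
      _ = _ := by ring
end
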